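/- arXiv:1603.07181 — 5 statements merged into one kernel-verified Lean document; each statement's English description precedes it below -/
import Mathlib

section
/- Let X, Y be nonempty finite sets, L a linear subspace of real-valued functions on X × Y, p a strictly positive probability distribution on X, k ∈ K(X;Y) a channel, and k₀ ∈ K(X;Y) a strictly positive channel. Let E be the closure of the exponential family E(k₀,L) and M = M_p(k,L) the mixture family. Then for a channel k' ∈ K(X;Y): k' ∈ M ∩ E if and only if k' ∈ E and D_p(k||k') = inf_{m ∈ E} D_p(k||m). -/
open scoped ENNReal BigOperators

/-- `k : X × Y → ℝ` is a channel (Markov kernel) from `X` to `Y`: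
nonnegative entries, rows summing to one. -/
def IsChannel {X Y : Type} [Fintype Y] (k : X × Y → ℝ) : Prop :=
  (∀ z, 0 ≤ k z) ∧ ∀ x : X, ∑ y : Y, k (x, y) = 1

/-- Channel divergence `D_p(k‖m)`, valued in `[0,∞]`, with the conventions
`0·log(0/t) = 0` and `t·log(t/0) = ∞` for `t > 0`. -/
noncomputable def chanDiv {X Y : Type} [Fintype X] [Fintype Y]
    (p : X → ℝ) (k m : X × Y → ℝ) : ℝ≥0∞ :=
  if ∀ z : X × Y, p z.1 * k z ≠ 0 → m z ≠ 0 then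
    ENNReal.ofReal (∑ z : X × Y, p z.1 * k z * Real.log (k z / m z))
  else ⊤

/-- The mixture family `M_p(k, L)` generated by the channel `k` and the linear
subspace `L` of functions on `X × Y`, with respect to the input distribution `p`. -/
def mixFam {X Y : Type} [Fintype X] [Fintype Y] (p : X → ℝ) (k : X × Y → ℝ)
    (L : Submodule ℝ (X × Y → ℝ)) : Set (X × Y → ℝ) :=
  {m | IsChannel m ∧
    ∀ l ∈ L, ∑ z : X × Y, p z.1 * m z * l z = ∑ z : X × Y, p z.1 * k z * l z}

/-- The exponential family `E(k₀, L)` generated by the reference channel `k₀` and the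
linear subspace `L` of functions on `X × Y`. -/
noncomputable def expFam {X Y : Type} [Fintype Y] (k₀ : X × Y → ℝ)
    (L : Submodule ℝ (X × Y → ℝ)) : Set (X × Y → ℝ) :=
  {m | ∃ l ∈ L, m = fun z : X × Y =>
    Real.exp (l z) * k₀ z / ∑ y : Y, Real.exp (l (z.1, y)) * k₀ (z.1, y)}

open Filter Topology

section ChannelLemmas

variable {X Y : Type} [Fintype Y]

/-- The normalization of `e^l m` in each row. -/
noncomputable def partition (l m : X × Y → ℝ) (x : X) : ℝ :=
  ∑ y : Y, Real.exp (l (x, y)) * m (x, y)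

/-- The exponential tilt of `m` by `l`. -/
noncomputable def tilt (l m : X × Y → ℝ) (z : X × Y) : ℝ :=
  Real.exp (l z) * m z / partition l m z.1

lemma partition_pos (l : X × Y → ℝ) {m : X × Y → ℝ} (hm : IsChannel m) (x : X) :
    0 < partition l m x := by
  have hnn : ∀ y ∈ Finset.univ, 0 ≤ Real.exp (l (x, y)) * m (x, y) := fun y _ =>
    mul_nonneg (Real.exp_pos _).le (hm.1 _)
  refine lt_of_le_of_ne (Finset.sum_nonneg hnn) fun h => ?_
  have h0 := (Finset.sum_eq_zero_iff_of_nonneg hnn).1 h.symm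
  have h1 : ∑ y : Y, m (x, y) = 0 := Finset.sum_eq_zero fun y hy =>
    (mul_eq_zero.1 (h0 y hy)).resolve_left (Real.exp_pos _).ne'
  rw [hm.2 x] at h1
  exact one_ne_zero h1

lemma tilt_isChannel (l : X × Y → ℝ) {m : X × Y → ℝ} (hm : IsChannel m) :
    IsChannel (tilt l m) := by
  refine ⟨fun z => div_nonneg (mul_nonneg (Real.exp_pos _).le (hm.1 _))
    (partition_pos l hm _).le, fun x => ?_⟩
  simp only [tilt]
  rw [← Finset.sum_div]
  exact div_self (partition_pos l hm x).ne'

lemma tilt_ne_zero (l : X × Y → ℝ) {m : X × Y → ℝ} (hm : IsChannel m) {z : X × Y}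
    (hz : m z ≠ 0) : tilt l m z ≠ 0 :=
  div_ne_zero (mul_ne_zero (Real.exp_pos _).ne' hz) (partition_pos l hm _).ne'

lemma tilt_tilt (l l' : X × Y → ℝ) {m : X × Y → ℝ} (hm : IsChannel m) :
    tilt l (tilt l' m) = tilt (l + l') m := by
  have hpart : ∀ x, partition l (tilt l' m) x = partition (l + l') m x / partition l' m x := by
    intro x
    simp only [partition, tilt, Finset.sum_div, Pi.add_apply, Real.exp_add]
    exact Finset.sum_congr rfl fun y _ => by ring
  funext z
  have h1 := (partition_pos l' hm z.1).ne'
  have h2 := (partition_pos (l + l') hm z.1).ne'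
  rw [tilt, hpart, tilt, tilt, Pi.add_apply, Real.exp_add]
  field_simp

lemma continuousAt_tilt (l : X × Y → ℝ) {m : X × Y → ℝ} (hm : IsChannel m) :
    ContinuousAt (tilt l) m := by
  refine continuousAt_pi.2 fun z => ContinuousAt.div ?_ ?_ (partition_pos l hm z.1).ne'
  · exact Continuous.continuousAt (by fun_prop)
  · exact Continuous.continuousAt (by unfold partition; fun_prop)

lemma mem_expFam_iff {k₀ m : X × Y → ℝ} {L : Submodule ℝ (X × Y → ℝ)} :
    m ∈ expFam k₀ L ↔ ∃ l ∈ L, m = tilt l k₀ := Iff.rfl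

lemma tilt_mem_closure_expFam {k₀ m l : X × Y → ℝ} {L : Submodule ℝ (X × Y → ℝ)}
    (hk₀ : IsChannel k₀) (hl : l ∈ L) (hm : IsChannel m) (hmE : m ∈ closure (expFam k₀ L)) :
    tilt l m ∈ closure (expFam k₀ L) := by
  refine (continuousAt_tilt l hm).continuousWithinAt.mem_closure hmE ?_
  rintro _ ⟨l', hl', rfl⟩
  exact mem_expFam_iff.2 ⟨l + l', L.add_mem hl hl', tilt_tilt l l' hk₀⟩

variable [Fintype X]

/-- The real sum underlying `chanDiv`. -/
noncomputable def divSum (p : X → ℝ) (k m : X × Y → ℝ) : ℝ :=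
  ∑ z : X × Y, p z.1 * k z * Real.log (k z / m z)

lemma sum_mul_channel (f : X → ℝ) {m : X × Y → ℝ} (hm : IsChannel m) :
    ∑ z : X × Y, f z.1 * m z = ∑ x, f x := by
  rw [Fintype.sum_prod_type]
  refine Finset.sum_congr rfl fun x _ => ?_
  simp only
  rw [← Finset.mul_sum, hm.2 x, mul_one]

lemma divSum_tilt (p : X → ℝ) (l : X × Y → ℝ) {k m : X × Y → ℝ} (hk : IsChannel k)
    (hm : IsChannel m) (hkm : ∀ z, k z ≠ 0 → m z ≠ 0) :
    divSum p k (tilt l m) = divSum p k m - ∑ z, p z.1 * k z * l z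
      + ∑ x, p x * Real.log (partition l m x) := by
  rw [← sum_mul_channel (fun x => p x * Real.log (partition l m x)) hk, divSum, divSum,
    ← Finset.sum_sub_distrib, ← Finset.sum_add_distrib]
  refine Finset.sum_congr rfl fun z _ => ?_
  by_cases hz : k z = 0
  · simp [hz]
  have hmz := hkm z hz
  have hZ := (partition_pos l hm z.1).ne'
  rw [Real.log_div hz (tilt_ne_zero l hm hmz), Real.log_div hz hmz, tilt,
    Real.log_div (mul_ne_zero (Real.exp_pos _).ne' hmz) hZ,
    Real.log_mul (Real.exp_pos _).ne' hmz, Real.log_exp]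
  ring

lemma sub_le_mul_log_div {a b : ℝ} (ha : 0 ≤ a) (hb : 0 ≤ b) (hab : a ≠ 0 → b ≠ 0) :
    a - b ≤ a * Real.log (a / b) := by
  rcases ha.eq_or_lt with rfl | ha
  · simpa using hb
  have hb' : 0 < b := lt_of_le_of_ne hb (hab ha.ne').symm
  have h := mul_le_mul_of_nonneg_left
    (Real.one_sub_inv_le_log_of_pos (div_pos ha hb')) ha.le
  have h2 : a * (1 - (a / b)⁻¹) = a - b := by field_simp
  linarith

lemma divSum_nonneg {p : X → ℝ} (hp : ∀ x, 0 < p x) {k m : X × Y → ℝ} (hk : IsChannel k)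
    (hm : IsChannel m) (hkm : ∀ z, k z ≠ 0 → m z ≠ 0) : 0 ≤ divSum p k m := by
  calc (0 : ℝ) = ∑ z : X × Y, p z.1 * (k z - m z) := by
        simp only [mul_sub, Finset.sum_sub_distrib, sum_mul_channel p hk, sum_mul_channel p hm,
          sub_self]
    _ ≤ divSum p k m := Finset.sum_le_sum fun z _ => by
        rw [mul_assoc]
        exact mul_le_mul_of_nonneg_left
          (sub_le_mul_log_div (hk.1 z) (hm.1 z) (hkm z)) (hp z.1).le

/-- A single term of the divergence is bounded by the total up to the mass of the input. -/
lemma mul_log_div_le_divSum {p : X → ℝ} (hp : ∀ x, 0 < p x) {k m : X × Y → ℝ}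
    (hk : IsChannel k) (hm : IsChannel m) (hkm : ∀ z, k z ≠ 0 → m z ≠ 0) (z : X × Y) :
    p z.1 * k z * Real.log (k z / m z) ≤ divSum p k m + ∑ x, p x := by
  rw [← sum_mul_channel p hm, divSum, ← Finset.sum_add_distrib]
  have hnn : ∀ w ∈ Finset.univ, 0 ≤ p w.1 * k w * Real.log (k w / m w) + p w.1 * m w := by
    intro w _
    have h := sub_le_mul_log_div (hk.1 w) (hm.1 w) (hkm w)
    have h2 : 0 ≤ k w * Real.log (k w / m w) + m w := by linarith [hk.1 w]
    have h3 := mul_nonneg (hp w.1).le h2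
    linarith
  have h := Finset.single_le_sum hnn (Finset.mem_univ z)
  have h' := mul_nonneg (hp z.1).le (hm.1 z)
  linarith

lemma divSum_self (p : X → ℝ) (k : X × Y → ℝ) : divSum p k k = 0 := by
  refine Finset.sum_eq_zero fun z _ => ?_
  by_cases hz : k z = 0 <;> simp [hz]

lemma continuousAt_divSum (p : X → ℝ) {k m : X × Y → ℝ} (hkm : ∀ z, k z ≠ 0 → m z ≠ 0) :
    ContinuousAt (divSum p k) m := by
  refine tendsto_finsetSum _ fun z _ => ?_
  by_cases hz : k z = 0
  · simp [hz]
  refine tendsto_const_nhds.mul (ContinuousAt.log ?_ (div_ne_zero hz (hkm z hz)))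
  exact continuousAt_const.div (continuous_apply z).continuousAt (hkm z hz)

lemma chanDiv_of_support {p : X → ℝ} {k m : X × Y → ℝ} (hkm : ∀ z, k z ≠ 0 → m z ≠ 0) :
    chanDiv p k m = ENNReal.ofReal (divSum p k m) :=
  if_pos fun z hz => hkm z (right_ne_zero_of_mul hz)

lemma support_of_chanDiv_ne_top {p : X → ℝ} (hp : ∀ x, 0 < p x) {k m : X × Y → ℝ}
    (h : chanDiv p k m ≠ ⊤) (z : X × Y) (hz : k z ≠ 0) : m z ≠ 0 := by
  by_contra hmz
  exact h (if_neg fun hall => hall z (mul_ne_zero (hp z.1).ne' hz) hmz)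

/-- Pythagorean-type identity for channels with the same `L`-moments. -/
lemma divSum_eq_add_of_mem_mixFam {p : X → ℝ} {k k' k₀ m : X × Y → ℝ}
    {L : Submodule ℝ (X × Y → ℝ)} (hk : IsChannel k) (hk₀ : IsChannel k₀)
    (hk₀_pos : ∀ z, 0 < k₀ z) (hk' : k' ∈ mixFam p k L) (hm : m ∈ expFam k₀ L) :
    divSum p k m = divSum p k k₀ - divSum p k' k₀ + divSum p k' m := by
  obtain ⟨l, hl, rfl⟩ := mem_expFam_iff.1 hm
  rw [divSum_tilt p l hk hk₀ fun z _ => (hk₀_pos z).ne',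
    divSum_tilt p l hk'.1 hk₀ fun z _ => (hk₀_pos z).ne', hk'.2 l hl]
  ring

/-- A channel of the mixture family in the closure of the exponential family dominates `k`. -/
lemma support_of_mem_mixFam_of_mem_closure {p : X → ℝ} (hp : ∀ x, 0 < p x)
    {k k' k₀ : X × Y → ℝ} {L : Submodule ℝ (X × Y → ℝ)} (hk : IsChannel k)
    (hk₀ : IsChannel k₀) (hk₀_pos : ∀ z, 0 < k₀ z) (hk' : k' ∈ mixFam p k L)
    (hE : k' ∈ closure (expFam k₀ L)) (z : X × Y) (hz : k z ≠ 0) : k' z ≠ 0 := by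
  have : (𝓝[expFam k₀ L] k').NeBot := mem_closure_iff_nhdsWithin_neBot.1 hE
  have hlim : Tendsto (divSum p k') (𝓝[expFam k₀ L] k') (𝓝 0) := by
    rw [← divSum_self p k']
    exact (continuousAt_divSum p fun z hz => hz).tendsto.mono_left nhdsWithin_le_nhds
  have hkz : 0 < k z := lt_of_le_of_ne (hk.1 z) hz.symm
  have hpk : 0 < p z.1 * k z := mul_pos (hp z.1) hkz
  set B := Real.log (k z) - (divSum p k k₀ - divSum p k' k₀ + 1 + ∑ x, p x) / (p z.1 * k z)
    with hB
  suffices h : Real.exp B ≤ k' z from ((Real.exp_pos B).trans_le h).ne'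
  have hz_lim : Tendsto (fun m : X × Y → ℝ => m z) (𝓝[expFam k₀ L] k') (𝓝 (k' z)) :=
    (continuous_apply z).continuousWithinAt
  refine ge_of_tendsto hz_lim ?_
  filter_upwards [hlim.eventually_lt_const one_pos, self_mem_nhdsWithin] with m hm1 hmE
  have hpyth := divSum_eq_add_of_mem_mixFam hk hk₀ hk₀_pos hk' hmE
  obtain ⟨l, -, rfl⟩ := mem_expFam_iff.1 hmE
  have hne : ∀ w, tilt l k₀ w ≠ 0 := fun w => tilt_ne_zero l hk₀ (hk₀_pos w).ne'
  have hch := tilt_isChannel l hk₀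
  have hmz : 0 < tilt l k₀ z := lt_of_le_of_ne (hch.1 z) (hne z).symm
  have hterm := mul_log_div_le_divSum hp hk hch (fun w _ => hne w) z
  refine (Real.le_log_iff_exp_le hmz).1 ?_
  rw [Real.log_div hz (hne z)] at hterm
  have : Real.log (k z) - Real.log (tilt l k₀ z) ≤
      (divSum p k k₀ - divSum p k' k₀ + 1 + ∑ x, p x) / (p z.1 * k z) := by
    rw [le_div_iff₀ hpk]
    linarith
  linarith

lemma chanDiv_le_of_mem_mixFam_of_mem_closure {p : X → ℝ} (hp : ∀ x, 0 < p x)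
    {k k' k₀ m : X × Y → ℝ} {L : Submodule ℝ (X × Y → ℝ)} (hk : IsChannel k)
    (hk₀ : IsChannel k₀) (hk₀_pos : ∀ z, 0 < k₀ z) (hk' : k' ∈ mixFam p k L)
    (hE : k' ∈ closure (expFam k₀ L)) (hm : m ∈ closure (expFam k₀ L)) :
    chanDiv p k k' ≤ chanDiv p k m := by
  by_cases htop : chanDiv p k m = ⊤
  · exact htop ▸ le_top
  have hkm := support_of_chanDiv_ne_top hp htop
  have hkk' := support_of_mem_mixFam_of_mem_closure hp hk hk₀ hk₀_pos hk' hE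
  rw [chanDiv_of_support hkm, chanDiv_of_support hkk']
  refine ENNReal.ofReal_le_ofReal ?_
  have : (𝓝[expFam k₀ L] k').NeBot := mem_closure_iff_nhdsWithin_neBot.1 hE
  have : (𝓝[expFam k₀ L] m).NeBot := mem_closure_iff_nhdsWithin_neBot.1 hm
  have hC : divSum p k k' = divSum p k k₀ - divSum p k' k₀ + divSum p k' k' := by
    refine tendsto_nhds_unique_of_eventuallyEq (l := 𝓝[expFam k₀ L] k')
      ((continuousAt_divSum p hkk').tendsto.mono_left nhdsWithin_le_nhds)
      (((continuousAt_divSum p fun z hz => hz).tendsto.mono_left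
        nhdsWithin_le_nhds).const_add _) ?_
    filter_upwards [self_mem_nhdsWithin] with n hn
    exact divSum_eq_add_of_mem_mixFam hk hk₀ hk₀_pos hk' hn
  rw [divSum_self, add_zero] at hC
  have hm_lim : Tendsto (divSum p k) (𝓝[expFam k₀ L] m) (𝓝 (divSum p k m)) :=
    (continuousAt_divSum p hkm).continuousWithinAt
  refine ge_of_tendsto hm_lim ?_
  filter_upwards [self_mem_nhdsWithin] with n hn
  rw [divSum_eq_add_of_mem_mixFam hk hk₀ hk₀_pos hk' hn, hC]
  obtain ⟨l, -, rfl⟩ := mem_expFam_iff.1 hn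
  have := divSum_nonneg hp hk'.1 (tilt_isChannel l hk₀)
    fun w _ => tilt_ne_zero l hk₀ (hk₀_pos w).ne'
  linarith

lemma hasDerivAt_divSum_tilt (p : X → ℝ) (l : X × Y → ℝ) {k m : X × Y → ℝ}
    (hk : IsChannel k) (hm : IsChannel m) (hkm : ∀ z, k z ≠ 0 → m z ≠ 0) :
    HasDerivAt (fun t : ℝ => divSum p k (tilt (t • l) m))
      (∑ z, p z.1 * m z * l z - ∑ z, p z.1 * k z * l z) 0 := by
  have hZ0 : ∀ x, partition ((0 : ℝ) • l) m x = 1 := fun x => by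
    simp [partition, hm.2 x]
  have hZ : ∀ x, HasDerivAt (fun t : ℝ => partition (t • l) m x)
      (∑ y, l (x, y) * m (x, y)) 0 := by
    intro x
    refine HasDerivAt.fun_sum fun y _ => ?_
    have h : HasDerivAt (fun t : ℝ => t * l (x, y)) (l (x, y)) 0 := by
      simpa using (hasDerivAt_id (0 : ℝ)).mul_const (l (x, y))
    simpa using h.exp.mul_const (m (x, y))
  have hlog : HasDerivAt (fun t : ℝ => ∑ x, p x * Real.log (partition (t • l) m x))
      (∑ z, p z.1 * m z * l z) 0 := by
    rw [Fintype.sum_prod_type]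
    refine HasDerivAt.fun_sum fun x _ => ?_
    refine (((hZ x).log (by rw [hZ0]; exact one_ne_zero)).const_mul (p x)).congr_deriv ?_
    rw [hZ0, div_one, Finset.mul_sum]
    exact Finset.sum_congr rfl fun y _ => by ring
  have hlin : HasDerivAt (fun t : ℝ => t * ∑ z, p z.1 * k z * l z)
      (∑ z, p z.1 * k z * l z) 0 := by
    simpa using (hasDerivAt_id (0 : ℝ)).mul_const (∑ z, p z.1 * k z * l z)
  have hfun : (fun t : ℝ => divSum p k (tilt (t • l) m)) = fun t =>
      divSum p k m - t * ∑ z, p z.1 * k z * l z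
        + ∑ x, p x * Real.log (partition (t • l) m x) := by
    funext t
    rw [divSum_tilt p (t • l) hk hm hkm, Finset.mul_sum]
    congr 2
    exact Finset.sum_congr rfl fun z _ => by simp only [Pi.smul_apply, smul_eq_mul]; ring
  rw [hfun]
  exact ((hlin.const_sub (divSum p k m)).add hlog).congr_deriv (by ring)

lemma mem_mixFam_of_forall_chanDiv_le {p : X → ℝ} (hp : ∀ x, 0 < p x)
    {k k' k₀ : X × Y → ℝ} {L : Submodule ℝ (X × Y → ℝ)} (hk : IsChannel k)
    (hk₀ : IsChannel k₀) (hk₀_pos : ∀ z, 0 < k₀ z) (hk' : IsChannel k')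
    (hE : k' ∈ closure (expFam k₀ L))
    (hmin : ∀ m ∈ closure (expFam k₀ L), chanDiv p k k' ≤ chanDiv p k m) :
    k' ∈ mixFam p k L := by
  have hk₀_div : chanDiv p k (tilt 0 k₀) ≠ ⊤ := by
    rw [chanDiv_of_support fun w _ => tilt_ne_zero 0 hk₀ (hk₀_pos w).ne']
    exact ENNReal.ofReal_ne_top
  have hsupp := support_of_chanDiv_ne_top hp (ne_top_of_le_ne_top hk₀_div
    (hmin _ (subset_closure (mem_expFam_iff.2 ⟨0, L.zero_mem, rfl⟩))))
  refine ⟨hk', fun l hl => ?_⟩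
  have hloc : IsLocalMin (fun t : ℝ => divSum p k (tilt (t • l) k')) 0 := by
    refine Eventually.of_forall fun t => ?_
    have htsupp : ∀ z, k z ≠ 0 → tilt (t • l) k' z ≠ 0 := fun z hz =>
      tilt_ne_zero _ hk' (hsupp z hz)
    have h := hmin _ (tilt_mem_closure_expFam hk₀ (L.smul_mem t hl) hk' hE)
    rw [chanDiv_of_support hsupp, chanDiv_of_support htsupp,
      ENNReal.ofReal_le_ofReal_iff (divSum_nonneg hp hk (tilt_isChannel _ hk') htsupp)] at h
    have h0 : tilt ((0 : ℝ) • l) k' = k' := by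
      funext z
      simp [tilt, partition, hk'.2 z.1]
    simpa only [h0] using h
  exact sub_eq_zero.1 (hloc.hasDerivAt_eq_zero (hasDerivAt_divSum_tilt p l hk hk' hsupp))

end ChannelLemmas

/-- **Duality (exponential side).** A channel `k'` lies in `M_p(k,L) ∩ cl(E(k₀,L))`
iff `k'` lies in `cl(E(k₀,L))` and realizes the infimum of `D_p(k‖·)` over `cl(E(k₀,L))`. -/
theorem mem_mix_inter_exp_iff_rIproj
    {X Y : Type} [Fintype X] [Fintype Y] [Nonempty X] [Nonempty Y]
    (L : Submodule ℝ (X × Y → ℝ))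
    (p : X → ℝ) (hp_pos : ∀ x, 0 < p x) (hp_sum : ∑ x, p x = 1)
    (k : X × Y → ℝ) (hk : IsChannel k)
    (k₀ : X × Y → ℝ) (hk₀ : IsChannel k₀) (hk₀_pos : ∀ z, 0 < k₀ z)
    (k' : X × Y → ℝ) (hk' : IsChannel k') :
    k' ∈ mixFam p k L ∩ closure (expFam k₀ L) ↔
      (k' ∈ closure (expFam k₀ L) ∧
        chanDiv p k k' = ⨅ m ∈ closure (expFam k₀ L), chanDiv p k m) := by
  constructor
  · rintro ⟨hM, hE⟩
    exact ⟨hE, le_antisymm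
      (le_iInf₂ fun m hm =>
        chanDiv_le_of_mem_mixFam_of_mem_closure hp_pos hk hk₀ hk₀_pos hM hE hm)
      (iInf₂_le k' hE)⟩
  · rintro ⟨hE, hinf⟩
    exact ⟨mem_mixFam_of_forall_chanDiv_le hp_pos hk hk₀ hk₀_pos hk' hE
      fun m hm => hinf.trans_le (iInf₂_le m hm), hE⟩
end

section
/- Let X, Y be nonempty finite sets, L a linear subspace of real-valued functions on X × Y, p a strictly positive probability distribution on X, k ∈ K(X;Y) a channel, and k₀ ∈ K(X;Y) a strictly positive channel. Then the intersection of the mixture family M_p(k,L) with the closure of the exponential family E(k₀,L) contains exactly one channel; in other words, there is a unique channel lying in the closure of E(k₀,L) whose p-weighted expectations of every function in L agree with those of k. -/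
open scoped ENNReal BigOperators

section

open Filter

variable {X Y : Type} [Fintype Y]

/-- The partition function `Z(x) = ∑_y e^{l(x,y)} k₀(x;y)`. -/
noncomputable def partitionFun (k₀ l : X × Y → ℝ) (x : X) : ℝ :=
  ∑ y : Y, Real.exp (l (x, y)) * k₀ (x, y)

/-- The member of the exponential family of `k₀` with exponent `l`. -/
noncomputable def gibbs (k₀ l : X × Y → ℝ) (z : X × Y) : ℝ :=
  Real.exp (l z) * k₀ z / partitionFun k₀ l z.1

theorem gibbs_mem_expFam (k₀ : X × Y → ℝ) {L : Submodule ℝ (X × Y → ℝ)} {l : X × Y → ℝ}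
    (hl : l ∈ L) : gibbs k₀ l ∈ expFam k₀ L :=
  ⟨l, hl, rfl⟩

theorem partitionFun_pos [Nonempty Y] {k₀ : X × Y → ℝ} (hk₀ : ∀ z, 0 < k₀ z) (l : X × Y → ℝ)
    (x : X) : 0 < partitionFun k₀ l x :=
  Finset.sum_pos (fun _ _ => mul_pos (Real.exp_pos _) (hk₀ _)) Finset.univ_nonempty

theorem gibbs_pos [Nonempty Y] {k₀ : X × Y → ℝ} (hk₀ : ∀ z, 0 < k₀ z) (l : X × Y → ℝ)
    (z : X × Y) : 0 < gibbs k₀ l z :=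
  div_pos (mul_pos (Real.exp_pos _) (hk₀ z)) (partitionFun_pos hk₀ l z.1)

theorem log_gibbs [Nonempty Y] {k₀ : X × Y → ℝ} (hk₀ : ∀ z, 0 < k₀ z) (l : X × Y → ℝ)
    (z : X × Y) :
    Real.log (gibbs k₀ l z) = l z + Real.log (k₀ z) - Real.log (partitionFun k₀ l z.1) := by
  rw [gibbs, Real.log_div (mul_pos (Real.exp_pos _) (hk₀ z)).ne' (partitionFun_pos hk₀ l _).ne',
    Real.log_mul (Real.exp_pos _).ne' (hk₀ z).ne', Real.log_exp]

theorem isChannel_gibbs [Nonempty Y] {k₀ : X × Y → ℝ} (hk₀ : ∀ z, 0 < k₀ z) (l : X × Y → ℝ) :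
    IsChannel (gibbs k₀ l) := by
  refine ⟨fun z => (gibbs_pos hk₀ l z).le, fun x => ?_⟩
  simp only [gibbs]
  rw [← Finset.sum_div]
  exact div_self (partitionFun_pos hk₀ l x).ne'

theorem IsChannel.le_one {k : X × Y → ℝ} (hk : IsChannel k) (z : X × Y) : k z ≤ 1 := by
  rw [← hk.2 z.1]
  exact Finset.single_le_sum (f := fun y => k (z.1, y)) (fun y _ => hk.1 _) (Finset.mem_univ z.2)

theorem isClosed_setOf_isChannel : IsClosed {k : X × Y → ℝ | IsChannel k} := by
  simp only [IsChannel, Set.ofPred_and, Set.ofPred_forall]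
  refine IsClosed.inter (isClosed_iInter fun z => isClosed_le continuous_const
    (continuous_apply z)) (isClosed_iInter fun x => isClosed_eq ?_ continuous_const)
  fun_prop

theorem isCompact_setOf_isChannel : IsCompact {k : X × Y → ℝ | IsChannel k} :=
  (isCompact_Icc (a := (0 : X × Y → ℝ)) (b := 1)).of_isClosed_subset isClosed_setOf_isChannel
    fun _ hk => ⟨fun z => hk.1 z, fun z => hk.le_one z⟩

variable [Fintype X]

/-- Weighted expectations of functions of the input do not depend on the channel. -/
theorem IsChannel.sum_mul_fst {k : X × Y → ℝ} (hk : IsChannel k) (p g : X → ℝ) :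
    ∑ z : X × Y, p z.1 * k z * g z.1 = ∑ x, p x * g x := by
  rw [Fintype.sum_prod_type]
  refine Finset.sum_congr rfl fun x _ => ?_
  simp only [mul_right_comm (p x) _ (g x)]
  rw [← Finset.mul_sum, hk.2, mul_one]

/-- Two members of the mixture family agree on differences of logarithms of members of the
exponential family. -/
theorem sum_sub_mul_log_gibbs_sub_eq_zero [Nonempty Y] {L : Submodule ℝ (X × Y → ℝ)} {p : X → ℝ}
    {k k₀ m m' l l' : X × Y → ℝ} (hk₀ : ∀ z, 0 < k₀ z) (hm : m ∈ mixFam p k L)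
    (hm' : m' ∈ mixFam p k L) (hl : l ∈ L) (hl' : l' ∈ L) :
    ∑ z, p z.1 * ((m z - m' z) *
      (Real.log (gibbs k₀ l z) - Real.log (gibbs k₀ l' z))) = 0 := by
  have hlin := (hm.2 _ (L.sub_mem hl hl')).trans (hm'.2 _ (L.sub_mem hl hl')).symm
  let g : X → ℝ := fun x => Real.log (partitionFun k₀ l' x) - Real.log (partitionFun k₀ l x)
  have hfst := (hm.1.sum_mul_fst p g).trans (hm'.1.sum_mul_fst p g).symm
  have hsplit : ∀ z : X × Y, p z.1 * ((m z - m' z) *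
      (Real.log (gibbs k₀ l z) - Real.log (gibbs k₀ l' z))) =
      (p z.1 * m z * (l - l') z - p z.1 * m' z * (l - l') z) +
      (p z.1 * m z * g z.1 - p z.1 * m' z * g z.1) := fun z => by
    simp only [log_gibbs hk₀, g, Pi.sub_apply]
    ring
  simp only [hsplit, Finset.sum_add_distrib, Finset.sum_sub_distrib]
  rw [hlin, hfst, sub_self, sub_self, add_zero]

theorem eq_of_mem_mixFam_of_mem_closure_expFam [Nonempty Y] {L : Submodule ℝ (X × Y → ℝ)}
    {p : X → ℝ} (hp : ∀ x, 0 < p x) {k k₀ m m' : X × Y → ℝ} (hk₀ : ∀ z, 0 < k₀ z)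
    (hm : m ∈ mixFam p k L) (hmE : m ∈ closure (expFam k₀ L))
    (hm' : m' ∈ mixFam p k L) (hmE' : m' ∈ closure (expFam k₀ L)) : m = m' := by
  obtain ⟨u, huE, hu⟩ := mem_closure_iff_seq_limit.1 hmE
  obtain ⟨v, hvE, hv⟩ := mem_closure_iff_seq_limit.1 hmE'
  rw [tendsto_pi_nhds] at hu hv
  have hev : ∀ᶠ n in atTop, ∀ z, (m z < m' z → u n z < v n z) ∧ (m' z < m z → v n z < u n z) := by
    refine eventually_all.2 fun z => ?_
    rw [eventually_and]
    simp only [eventually_imp_distrib_left]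
    exact ⟨fun h => (hu z).eventually_lt (hv z) h, fun h => (hv z).eventually_lt (hu z) h⟩
  obtain ⟨n, hn⟩ := hev.exists
  obtain ⟨l, hl, hul⟩ := huE n
  obtain ⟨l', hl', hvl⟩ := hvE n
  replace hul : u n = gibbs k₀ l := hul
  replace hvl : v n = gibbs k₀ l' := hvl
  simp only [hul, hvl] at hn
  have hpos : ∀ z, m z ≠ m' z → 0 < p z.1 * ((m z - m' z) *
      (Real.log (gibbs k₀ l z) - Real.log (gibbs k₀ l' z))) := fun z hz => by
    refine mul_pos (hp _) ?_
    rcases hz.lt_or_gt with h | h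
    · exact mul_pos_of_neg_of_neg (sub_neg.2 h)
        (sub_neg.2 (Real.log_lt_log (gibbs_pos hk₀ l z) ((hn z).1 h)))
    · exact mul_pos (sub_pos.2 h)
        (sub_pos.2 (Real.log_lt_log (gibbs_pos hk₀ l' z) ((hn z).2 h)))
  have hzero := sum_sub_mul_log_gibbs_sub_eq_zero hk₀ hm hm' hl hl'
  rw [Finset.sum_eq_zero_iff_of_nonneg] at hzero
  · ext z
    by_contra hz
    exact (hpos z hz).ne' (hzero z (Finset.mem_univ z))
  · intro z _
    by_cases hz : m z = m' z
    · simp [hz]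
    · exact (hpos z hz).le

/-- The negative log-likelihood of `gibbs k₀ l` relative to `k`. -/
noncomputable def negLogLik (p : X → ℝ) (k k₀ l : X × Y → ℝ) : ℝ :=
  ∑ x, p x * Real.log (partitionFun k₀ l x) - ∑ z : X × Y, p z.1 * k z * l z

theorem negLogLik_zero {p : X → ℝ} {k k₀ : X × Y → ℝ} (hk₀ : IsChannel k₀) :
    negLogLik p k k₀ 0 = 0 := by
  simp [negLogLik, partitionFun, hk₀.2]

theorem sum_mul_log_le_negLogLik {p : X → ℝ} (hp : ∀ x, 0 ≤ p x) {k k₀ : X × Y → ℝ}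
    (hk : IsChannel k) (hk₀ : ∀ z, 0 < k₀ z) (l : X × Y → ℝ) :
    ∑ z : X × Y, p z.1 * k z * Real.log (k₀ z) ≤ negLogLik p k k₀ l := by
  rw [negLogLik, ← hk.sum_mul_fst p fun x => Real.log (partitionFun k₀ l x), le_sub_iff_add_le,
    ← Finset.sum_add_distrib]
  refine Finset.sum_le_sum fun z _ => ?_
  rw [← mul_add]
  refine mul_le_mul_of_nonneg_left ?_ (mul_nonneg (hp _) (hk.1 z))
  rw [← Real.log_exp (l z), ← Real.log_mul (hk₀ z).ne' (Real.exp_pos _).ne', mul_comm]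
  refine Real.log_le_log (mul_pos (Real.exp_pos _) (hk₀ z)) ?_
  exact Finset.single_le_sum (f := fun y => Real.exp (l (z.1, y)) * k₀ (z.1, y))
    (fun y _ => (mul_pos (Real.exp_pos _) (hk₀ _)).le) (Finset.mem_univ z.2)

theorem continuous_negLogLik [Nonempty Y] (p : X → ℝ) (k : X × Y → ℝ) {k₀ : X × Y → ℝ}
    (hk₀ : ∀ z, 0 < k₀ z) : Continuous (negLogLik p k k₀) := by
  refine Continuous.sub (continuous_finsetSum _ fun x _ => continuous_const.mul
    (Continuous.log ?_ fun l => (partitionFun_pos hk₀ l x).ne')) (by fun_prop)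
  unfold partitionFun
  fun_prop

theorem hasDerivAt_negLogLik [Nonempty Y] (p : X → ℝ) (k : X × Y → ℝ) {k₀ : X × Y → ℝ}
    (hk₀ : ∀ z, 0 < k₀ z) (l h : X × Y → ℝ) :
    HasDerivAt (fun t : ℝ => negLogLik p k k₀ (l + t • h))
      (∑ z, p z.1 * gibbs k₀ l z * h z - ∑ z : X × Y, p z.1 * k z * h z) 0 := by
  have hline : ∀ z, HasDerivAt (fun t : ℝ => (l + t • h) z) (h z) 0 := fun z => by
    simpa using ((hasDerivAt_id (0 : ℝ)).mul_const (h z)).const_add (l z)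
  have hZ : ∀ x, HasDerivAt (fun t : ℝ => partitionFun k₀ (l + t • h) x)
      (∑ y, Real.exp (l (x, y)) * h (x, y) * k₀ (x, y)) 0 := fun x => by
    refine HasDerivAt.fun_sum fun y _ => HasDerivAt.mul_const ?_ _
    simpa using (hline (x, y)).exp
  have hlog : ∀ x, HasDerivAt (fun t : ℝ => Real.log (partitionFun k₀ (l + t • h) x))
      (∑ y, gibbs k₀ l (x, y) * h (x, y)) 0 := fun x => by
    convert (hZ x).log (partitionFun_pos hk₀ _ x).ne' using 1
    rw [Finset.sum_div]
    refine Finset.sum_congr rfl fun y _ => ?_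
    simp only [gibbs, zero_smul, add_zero]
    ring
  refine HasDerivAt.sub ?_ (HasDerivAt.fun_sum fun z _ => (hline z).const_mul _)
  rw [Fintype.sum_prod_type]
  simp only [mul_assoc, ← Finset.mul_sum]
  exact HasDerivAt.fun_sum fun x _ => (hlog x).const_mul _

/-- The ridge-penalized likelihood attains its optimum on `L`. -/
theorem exists_isMinOn_negLogLik_add [Nonempty Y] (L : Submodule ℝ (X × Y → ℝ)) {p : X → ℝ}
    (hp : ∀ x, 0 ≤ p x) {k k₀ : X × Y → ℝ} (hk : IsChannel k) (hk₀ : ∀ z, 0 < k₀ z)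
    {ε : ℝ} (hε : 0 < ε) :
    ∃ l ∈ L, IsMinOn (fun l => negLogLik p k k₀ l + ε * ∑ z, l z ^ 2) (L : Set (X × Y → ℝ)) l := by
  have hcont : Continuous fun l => negLogLik p k k₀ l + ε * ∑ z, l z ^ 2 :=
    (continuous_negLogLik p k hk₀).add (by fun_prop)
  refine hcont.continuousOn.exists_isMinOn' L.closed_of_finiteDimensional L.zero_mem
    (Eventually.filter_mono inf_le_left ?_)
  have hsq : ∀ l : X × Y → ℝ, ‖l‖ ^ 2 ≤ ∑ z, l z ^ 2 := fun l => by
    have hnn : 0 ≤ ∑ z, l z ^ 2 := Finset.sum_nonneg fun z _ => sq_nonneg _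
    refine (Real.le_sqrt (norm_nonneg l) hnn).1 ((pi_norm_le_iff_of_nonneg (Real.sqrt_nonneg _)).2
      fun z => Real.abs_le_sqrt ?_)
    exact Finset.single_le_sum (f := fun z => l z ^ 2) (fun z _ => sq_nonneg _) (Finset.mem_univ z)
  have htend : Tendsto (fun l : X × Y → ℝ =>
      ∑ z : X × Y, p z.1 * k z * Real.log (k₀ z) + ε * ‖l‖ ^ 2) (cocompact _) atTop :=
    tendsto_atTop_add_const_left _ _ (((tendsto_pow_atTop two_ne_zero).comp
      tendsto_norm_cocompact_atTop).const_mul_atTop hε)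
  filter_upwards [htend.eventually_ge_atTop _] with l hl
  exact hl.trans (add_le_add (sum_mul_log_le_negLogLik hp hk hk₀ l)
    (mul_le_mul_of_nonneg_left (hsq l) hε.le))

/-- The moments of `k` are matched approximately within the exponential family. -/
theorem exists_mem_sq_moment_sub_le [Nonempty Y] (L : Submodule ℝ (X × Y → ℝ)) {p : X → ℝ}
    (hp : ∀ x, 0 ≤ p x) {k k₀ : X × Y → ℝ} (hk : IsChannel k) (hk₀ : IsChannel k₀)
    (hk₀_pos : ∀ z, 0 < k₀ z) {ε : ℝ} (hε : 0 < ε) :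
    ∃ l ∈ L, ∀ h ∈ L,
      (∑ z, p z.1 * gibbs k₀ l z * h z - ∑ z : X × Y, p z.1 * k z * h z) ^ 2 ≤
        ε * (4 * (-∑ z : X × Y, p z.1 * k z * Real.log (k₀ z)) * ∑ z, h z ^ 2) := by
  obtain ⟨l, hl, hmin⟩ := exists_isMinOn_negLogLik_add L hp hk hk₀_pos hε
  refine ⟨l, hl, fun h hh => ?_⟩
  have hpen : ε * ∑ z, l z ^ 2 ≤ -∑ z : X × Y, p z.1 * k z * Real.log (k₀ z) := by
    have h0 := hmin L.zero_mem
    have hlow := sum_mul_log_le_negLogLik hp hk hk₀_pos l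
    simp only [Set.mem_ofPred_eq, negLogLik_zero hk₀, Pi.zero_apply, ne_eq, OfNat.ofNat_ne_zero,
      not_false_eq_true, zero_pow, Finset.sum_const_zero, mul_zero, add_zero] at h0
    linarith
  have hsq : HasDerivAt (fun t : ℝ => ε * ∑ z, (l + t • h) z ^ 2)
      (ε * ∑ z, 2 * (l z * h z)) 0 := by
    refine HasDerivAt.const_mul ε (HasDerivAt.fun_sum fun z _ => ?_)
    have hline : HasDerivAt (fun t : ℝ => (l + t • h) z) (h z) 0 := by
      simpa using ((hasDerivAt_id (0 : ℝ)).mul_const (h z)).const_add (l z)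
    simpa [mul_assoc] using hline.fun_pow 2
  have hcrit := IsLocalMin.hasDerivAt_eq_zero (Eventually.of_forall fun t => by
    simpa using hmin (L.add_mem hl (L.smul_mem t hh)))
    ((hasDerivAt_negLogLik p k hk₀_pos l h).add hsq)
  rw [eq_neg_of_add_eq_zero_left hcrit, neg_sq, ← Finset.mul_sum]
  have hcs := Finset.sum_mul_sq_le_sq_mul_sq Finset.univ l h
  have hnn : 0 ≤ ∑ z, h z ^ 2 := Finset.sum_nonneg fun z _ => sq_nonneg _
  calc (ε * (2 * ∑ z, l z * h z)) ^ 2 = 4 * ε ^ 2 * (∑ z, l z * h z) ^ 2 := by ring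
    _ ≤ 4 * ε ^ 2 * ((∑ z, l z ^ 2) * ∑ z, h z ^ 2) := by gcongr
    _ = ε * (4 * (ε * ∑ z, l z ^ 2) * ∑ z, h z ^ 2) := by ring
    _ ≤ _ := by gcongr

theorem exists_mem_mixFam_inter_closure_expFam [Nonempty Y] (L : Submodule ℝ (X × Y → ℝ))
    {p : X → ℝ} (hp : ∀ x, 0 ≤ p x) {k k₀ : X × Y → ℝ} (hk : IsChannel k) (hk₀ : IsChannel k₀)
    (hk₀_pos : ∀ z, 0 < k₀ z) : ∃ m, m ∈ mixFam p k L ∩ closure (expFam k₀ L) := by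
  choose l hl hmom using fun n : ℕ =>
    exists_mem_sq_moment_sub_le L hp hk hk₀ hk₀_pos (Nat.one_div_pos_of_nat (α := ℝ) (n := n))
  obtain ⟨m, hm, φ, hφ, hlim⟩ :=
    isCompact_setOf_isChannel.tendsto_subseq fun n => isChannel_gibbs hk₀_pos (l n)
  refine ⟨m, ⟨hm, fun h hh => ?_⟩,
    mem_closure_of_tendsto hlim (Eventually.of_forall fun n => gibbs_mem_expFam k₀ (hl _))⟩
  have hcont : Continuous fun m : X × Y → ℝ =>
      (∑ z : X × Y, p z.1 * m z * h z - ∑ z : X × Y, p z.1 * k z * h z) ^ 2 := by fun_prop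
  have hbound := ((tendsto_one_div_add_atTop_nhds_zero_nat (𝕜 := ℝ)).comp
    hφ.tendsto_atTop).mul_const
      (4 * (-∑ z : X × Y, p z.1 * k z * Real.log (k₀ z)) * ∑ z, h z ^ 2)
  have hle := le_of_tendsto_of_tendsto' ((hcont.tendsto m).comp hlim) hbound
    fun n => hmom (φ n) h hh
  rw [zero_mul] at hle
  exact sub_eq_zero.1 (pow_eq_zero_iff two_ne_zero |>.1 (hle.antisymm (sq_nonneg _)))

end

/-- **Duality (uniqueness of the intersection point).** The mixture family `M_p(k,L)`
and the closure of the exponential family `E(k₀,L)` intersect in exactly one channel. -/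
theorem existsUnique_mem_mix_inter_exp
    {X Y : Type} [Fintype X] [Fintype Y] [Nonempty X] [Nonempty Y]
    (L : Submodule ℝ (X × Y → ℝ))
    (p : X → ℝ) (hp_pos : ∀ x, 0 < p x) (hp_sum : ∑ x, p x = 1)
    (k : X × Y → ℝ) (hk : IsChannel k)
    (k₀ : X × Y → ℝ) (hk₀ : IsChannel k₀) (hk₀_pos : ∀ z, 0 < k₀ z) :
    ∃! k' : X × Y → ℝ, k' ∈ mixFam p k L ∩ closure (expFam k₀ L) := by
  obtain ⟨m, hm⟩ :=
    exists_mem_mixFam_inter_closure_expFam L (fun x => (hp_pos x).le) hk hk₀ hk₀_pos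
  exact ⟨m, hm, fun m' hm' =>
    eq_of_mem_mixFam_of_mem_closure_expFam hp_pos hk₀_pos hm'.1 hm'.2 hm.1 hm.2⟩
end

section
/- Let X, Y be nonempty finite sets, p a strictly positive probability distribution on X, k ∈ K(X;Y) a channel, k₀ ∈ K(X;Y) a strictly positive channel, and f₁,…,f_d real-valued functions on X × Y. For θ ∈ ℝ^d define k_θ(x;y) := k₀(x;y) exp( ∑_{j=1}^d θ_j f_j(x,y) ) / Z_θ(x), where Z_θ(x) := ∑_y k₀(x;y) exp( ∑_{j=1}^d θ_j f_j(x,y) ). Then the function θ ↦ D_p(k||k_θ) is differentiable on ℝ^d, and its partial derivative with respect to θ_j equals ∑_{x,y} p(x) k_θ(x;y) f_j(x,y) − ∑_{x,y} p(x) k(x;y) f_j(x,y); in particular the gradient vanishes at θ if and only if ∑_{x,y} p(x) k_θ(x;y) f_j(x,y) = ∑_{x,y} p(x) k(x;y) f_j(x,y) for all j. -/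
open scoped BigOperators

/-- The exponential curve `θ ↦ k_θ` through `k₀` with sufficient statistics `f₁,…,f_d`:
`k_θ(x;y) = k₀(x;y) exp(∑ⱼ θⱼ fⱼ(x,y)) / Z_θ(x)`. -/
noncomputable def expCh {X Y : Type} [Fintype Y] (k₀ : X × Y → ℝ) {d : ℕ}
    (f : Fin d → X × Y → ℝ) (θ : Fin d → ℝ) : X × Y → ℝ :=
  fun z => k₀ z * Real.exp (∑ j, θ j * f j z) /
    ∑ y : Y, k₀ (z.1, y) * Real.exp (∑ j, θ j * f j (z.1, y))

open ContinuousLinearMap in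
/-- The linear functional `θ ↦ ∑ⱼ θⱼ fⱼ(z)`. -/
noncomputable def statFunctional {ι Z : Type*} [Fintype ι] (f : ι → Z → ℝ) (z : Z) :
    (ι → ℝ) →L[ℝ] ℝ :=
  ∑ j, f j z • proj (R := ℝ) (φ := fun _ : ι => ℝ) j

lemma statFunctional_apply {ι Z : Type*} [Fintype ι] (f : ι → Z → ℝ) (z : Z) (θ : ι → ℝ) :
    statFunctional f z θ = ∑ j, θ j * f j z := by
  simp [statFunctional, mul_comm]

lemma statFunctional_single {ι Z : Type*} [Fintype ι] [DecidableEq ι] (f : ι → Z → ℝ) (z : Z)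
    (j : ι) : statFunctional f z (Pi.single j 1) = f j z := by
  simp [statFunctional_apply, Pi.single_apply]

lemma hasFDerivAt_log_partition {ι Y : Type*} [Fintype ι] [Fintype Y] [Nonempty Y]
    (w : Y → ℝ) (hw : ∀ y, 0 < w y) (f : ι → Y → ℝ) (θ : ι → ℝ) :
    HasFDerivAt (fun θ : ι → ℝ => Real.log (∑ y, w y * Real.exp (∑ j, θ j * f j y)))
      (∑ y, (w y * Real.exp (∑ j, θ j * f j y) / ∑ y', w y' * Real.exp (∑ j, θ j * f j y')) •
        statFunctional f y) θ := by
  have hZ : 0 < ∑ y, w y * Real.exp (∑ j, θ j * f j y) :=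
    Finset.sum_pos (fun y _ => mul_pos (hw y) (Real.exp_pos _)) Finset.univ_nonempty
  simp_rw [← statFunctional_apply] at hZ ⊢
  have hsum := HasFDerivAt.fun_sum (u := Finset.univ) fun y _ =>
    ((statFunctional f y).hasFDerivAt (x := θ)).exp.const_mul (w y)
  refine (hsum.log hZ.ne').congr_fderiv ?_
  rw [Finset.smul_sum]
  refine Finset.sum_congr rfl fun y _ => ?_
  rw [smul_smul, smul_smul, div_eq_inv_mul, mul_assoc]

lemma mul_log_div_expCh {X Y : Type} [Fintype Y] [Nonempty Y] (k k₀ : X × Y → ℝ)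
    (hk₀_pos : ∀ z, 0 < k₀ z) {d : ℕ} (f : Fin d → X × Y → ℝ) (θ : Fin d → ℝ) (z : X × Y) :
    k z * Real.log (k z / expCh k₀ f θ z) =
      k z * (Real.log (k z) - Real.log (k₀ z) - ∑ j, θ j * f j z
        + Real.log (∑ y : Y, k₀ (z.1, y) * Real.exp (∑ j, θ j * f j (z.1, y)))) := by
  have hZ : 0 < ∑ y : Y, k₀ (z.1, y) * Real.exp (∑ j, θ j * f j (z.1, y)) :=
    Finset.sum_pos (fun y _ => mul_pos (hk₀_pos _) (Real.exp_pos _)) Finset.univ_nonempty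
  rcases eq_or_ne (k z) 0 with h | h
  · simp [h]
  have hnum : k₀ z * Real.exp (∑ j, θ j * f j z) ≠ 0 :=
    (mul_pos (hk₀_pos z) (Real.exp_pos _)).ne'
  rw [expCh, Real.log_div h (div_ne_zero hnum hZ.ne'), Real.log_div hnum hZ.ne',
    Real.log_mul (hk₀_pos z).ne' (Real.exp_ne_zero _), Real.log_exp]
  ring

lemma hasFDerivAt_divergence_expCh {X Y : Type} [Fintype X] [Fintype Y] [Nonempty Y]
    (p : X → ℝ) (k : X × Y → ℝ) (hk : IsChannel k) (k₀ : X × Y → ℝ) (hk₀_pos : ∀ z, 0 < k₀ z)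
    {d : ℕ} (f : Fin d → X × Y → ℝ) (θ : Fin d → ℝ) :
    HasFDerivAt (fun θ => ∑ z : X × Y, p z.1 * k z * Real.log (k z / expCh k₀ f θ z))
      (∑ z : X × Y, (p z.1 * expCh k₀ f θ z) • statFunctional f z
        - ∑ z : X × Y, (p z.1 * k z) • statFunctional f z) θ := by
  simp_rw [mul_assoc (p _) (k _) (Real.log _), mul_log_div_expCh k k₀ hk₀_pos]
  simp_rw [← mul_assoc]
  have hterm (z : X × Y) : HasFDerivAt
      (fun θ : Fin d → ℝ => p z.1 * k z * (Real.log (k z) - Real.log (k₀ z) - ∑ j, θ j * f j z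
        + Real.log (∑ y : Y, k₀ (z.1, y) * Real.exp (∑ j, θ j * f j (z.1, y)))))
      ((p z.1 * k z) • (-statFunctional f z
        + ∑ y, expCh k₀ f θ (z.1, y) • statFunctional f (z.1, y))) θ := by
    have hlin : HasFDerivAt (fun θ : Fin d → ℝ => ∑ j, θ j * f j z) (statFunctional f z) θ := by
      simp_rw [← statFunctional_apply]
      exact (statFunctional f z).hasFDerivAt
    exact ((hlin.const_sub _).add (hasFDerivAt_log_partition (fun y => k₀ (z.1, y))
      (fun y => hk₀_pos _) (fun j y => f j (z.1, y)) θ)).const_mul _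
  refine (HasFDerivAt.fun_sum (u := Finset.univ) fun z _ => hterm z).congr_fderiv ?_
  symm
  simp_rw [smul_add, smul_neg, Finset.sum_add_distrib, Finset.sum_neg_distrib]
  rw [sub_eq_neg_add]
  congr 1
  simp_rw [Fintype.sum_prod_type]
  refine Finset.sum_congr rfl fun x _ => ?_
  rw [← Finset.sum_smul, ← Finset.mul_sum, hk.2 x, mul_one, Finset.smul_sum]
  simp_rw [smul_smul]

/-- The map `θ ↦ D_p(k‖k_θ)` is differentiable; its partial derivative in `θⱼ` is
`E_{p k_θ}[fⱼ] − E_{p k}[fⱼ]`, so its gradient vanishes at `θ` iff the `p`-weighted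
expectations of every `fⱼ` under `k_θ` and under `k` agree. -/
theorem divergence_differentiable_partialDeriv
    {X Y : Type} [Fintype X] [Fintype Y] [Nonempty X] [Nonempty Y]
    (p : X → ℝ) (hp_pos : ∀ x, 0 < p x) (hp_sum : ∑ x, p x = 1)
    (k : X × Y → ℝ) (hk : IsChannel k)
    (k₀ : X × Y → ℝ) (hk₀ : IsChannel k₀) (hk₀_pos : ∀ z, 0 < k₀ z)
    {d : ℕ} (f : Fin d → X × Y → ℝ)
    (F : (Fin d → ℝ) → ℝ)
    (hF : F = fun θ => ∑ z : X × Y, p z.1 * k z * Real.log (k z / expCh k₀ f θ z)) :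
    Differentiable ℝ F ∧
    (∀ (θ : Fin d → ℝ) (j : Fin d),
      HasDerivAt (fun t : ℝ => F (Function.update θ j t))
        ((∑ z : X × Y, p z.1 * expCh k₀ f θ z * f j z)
          - ∑ z : X × Y, p z.1 * k z * f j z) (θ j)) ∧
    (∀ θ : Fin d → ℝ,
      fderiv ℝ F θ = 0 ↔
        ∀ j : Fin d, ∑ z : X × Y, p z.1 * expCh k₀ f θ z * f j z
          = ∑ z : X × Y, p z.1 * k z * f j z) := by
  have hderiv (θ : Fin d → ℝ) := hF ▸ hasFDerivAt_divergence_expCh p k hk k₀ hk₀_pos f θ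
  have happly (θ : Fin d → ℝ) (j : Fin d) : fderiv ℝ F θ (Pi.single j 1) =
      (∑ z : X × Y, p z.1 * expCh k₀ f θ z * f j z) - ∑ z : X × Y, p z.1 * k z * f j z := by
    rw [(hderiv θ).fderiv]
    simp [statFunctional_single]
  refine ⟨fun θ => (hderiv θ).differentiableAt, fun θ j => ?_, fun θ => ?_⟩
  · rw [← happly]
    have hF' : HasFDerivAt F (fderiv ℝ F θ) (Function.update θ j (θ j)) := by
      rw [Function.update_eq_self]
      exact (hderiv θ).differentiableAt.hasFDerivAt
    exact hF'.comp_hasDerivAt (θ j) (hasDerivAt_update θ j (θ j))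
  · simp_rw [← sub_eq_zero (b := ∑ z : X × Y, p z.1 * k z * f _ z), ← happly]
    refine ⟨fun h j => by simp [h], fun h => ?_⟩
    refine ContinuousLinearMap.coe_injective (LinearMap.pi_ext' fun j => ?_)
    ext
    simpa using h j
end

section
/- Let X = ∏_{i∈V} X_i and Y = ∏_{j∈W} Y_j be finite products of nonempty finite sets, p a strictly positive probability distribution on X, I ⊆ V, J ⊆ W with J nonempty, and k, k̄ ∈ K(X;Y) channels. Let F_{IJ} be the space of real functions on X × Y that depend only on the coordinates x_I and y_J. Then the following are equivalent: (i) ∑_{x,y} p(x) k(x;y) f(x,y) = ∑_{x,y} p(x) k̄(x;y) f(x,y) for every f ∈ F_{IJ}; (ii) p(x_I) k(x_I;y_J) = p(x_I) k̄(x_I;y_J) for all x_I, y_J. In other words, the mixture family of channels with prescribed (I,J)-marginal equal to that of k̄ coincides with the mixture family M_p(k̄, F_{IJ}). -/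
open scoped BigOperators ENNReal

variable {N M : ℕ} {X : Fin N → Type} {Y : Fin M → Type}

/-- Restriction of a configuration to the coordinates in `I`. -/
def restr (I : Finset (Fin N)) (x : ∀ i, X i) : ∀ i : I, X i.1 :=
  fun i => x i.1

/-- The `X_I`-marginal `p(x_I)` of a distribution `p` on `X = ∏ᵢ Xᵢ`. -/
def margP [∀ i, Fintype (X i)] [∀ i, DecidableEq (X i)]
    (p : (∀ i, X i) → ℝ) (I : Finset (Fin N)) (ξ : ∀ i : I, X i.1) : ℝ :=
  ∑ x : ∀ i, X i, if restr I x = ξ then p x else 0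

/-- The channel marginal `k(x_I; y_J) = ∑_{x_{Iᶜ}, y_{Jᶜ}} p(x_{Iᶜ}|x_I) k(x;y)`,
taken with respect to the input distribution `p`. -/
noncomputable def margK [∀ i, Fintype (X i)] [∀ i, DecidableEq (X i)]
    [∀ j, Fintype (Y j)] [∀ j, DecidableEq (Y j)]
    (p : (∀ i, X i) → ℝ) (k : (∀ i, X i) → (∀ j, Y j) → ℝ)
    (I : Finset (Fin N)) (J : Finset (Fin M))
    (ξ : ∀ i : I, X i.1) (η : ∀ j : J, Y j.1) : ℝ :=
  ∑ x : ∀ i, X i, ∑ y : ∀ j, Y j,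
    if restr I x = ξ ∧ restr J y = η then (p x / margP p I ξ) * k x y else 0

/-- The `(X_I, Y_J)`-marginal `pk(x_I, y_J)` of the joint distribution
`pk(x,y) = p(x) k(x;y)`. -/
def margJoint [∀ i, Fintype (X i)] [∀ i, DecidableEq (X i)]
    [∀ j, Fintype (Y j)] [∀ j, DecidableEq (Y j)]
    (p : (∀ i, X i) → ℝ) (k : (∀ i, X i) → (∀ j, Y j) → ℝ)
    (I : Finset (Fin N)) (J : Finset (Fin M))
    (ξ : ∀ i : I, X i.1) (η : ∀ j : J, Y j.1) : ℝ :=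
  ∑ x : ∀ i, X i, ∑ y : ∀ j, Y j,
    if restr I x = ξ ∧ restr J y = η then p x * k x y else 0

/-- Restriction to a set of coordinates is surjective when all coordinate spaces are nonempty. -/
lemma restr_surjective {n : ℕ} {Z : Fin n → Type} [∀ i, Nonempty (Z i)] (I : Finset (Fin n)) :
    Function.Surjective (restr (X := Z) I) := by
  intro ξ
  refine ⟨fun i => if h : i ∈ I then ξ ⟨i, h⟩ else Classical.arbitrary _, ?_⟩
  funext i
  simp [restr]

lemma margP_pos [∀ i, Fintype (X i)] [∀ i, Nonempty (X i)] [∀ i, DecidableEq (X i)]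
    {p : (∀ i, X i) → ℝ} (hp : ∀ x, 0 < p x) (I : Finset (Fin N)) (ξ : ∀ i : I, X i.1) :
    0 < margP p I ξ := by
  obtain ⟨x, rfl⟩ := restr_surjective I ξ
  refine Finset.sum_pos' (fun x' _ => ?_) ⟨x, Finset.mem_univ x, ?_⟩
  · split_ifs
    · exact (hp x').le
    · exact le_rfl
  · simpa using hp x

lemma margP_mul_margK [∀ i, Fintype (X i)] [∀ i, DecidableEq (X i)]
    [∀ j, Fintype (Y j)] [∀ j, DecidableEq (Y j)]
    {p : (∀ i, X i) → ℝ} (k : (∀ i, X i) → (∀ j, Y j) → ℝ)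
    (I : Finset (Fin N)) (J : Finset (Fin M))
    {ξ : ∀ i : I, X i.1} (η : ∀ j : J, Y j.1) (hξ : margP p I ξ ≠ 0) :
    margP p I ξ * margK p k I J ξ η = margJoint p k I J ξ η := by
  simp only [margK, margJoint, Finset.mul_sum, mul_ite, mul_zero]
  refine Finset.sum_congr rfl fun x _ => Finset.sum_congr rfl fun y _ => ?_
  rw [← mul_assoc, mul_div_cancel₀ _ hξ]

/-- The expectation of a function of `(x_I, y_J)` is its expectation under the joint marginal. -/
lemma sum_mul_restr_eq_sum_margJoint [∀ i, Fintype (X i)] [∀ i, DecidableEq (X i)]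
    [∀ j, Fintype (Y j)] [∀ j, DecidableEq (Y j)]
    (p : (∀ i, X i) → ℝ) (k : (∀ i, X i) → (∀ j, Y j) → ℝ)
    (I : Finset (Fin N)) (J : Finset (Fin M))
    (g : (∀ i : I, X i.1) → (∀ j : J, Y j.1) → ℝ) :
    ∑ x, ∑ y, p x * k x y * g (restr I x) (restr J y) =
      ∑ ξ, ∑ η, margJoint p k I J ξ η * g ξ η := by
  simp only [margJoint, Finset.sum_mul]
  rw [← Fintype.sum_prod_type' (f := fun (ξ : ∀ i : I, X i.1) (η : ∀ j : J, Y j.1) =>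
    ∑ x, ∑ y, (if restr I x = ξ ∧ restr J y = η then p x * k x y else 0) * g ξ η)]
  refine Eq.trans ?_ Finset.sum_comm
  refine Finset.sum_congr rfl fun x _ => ?_
  rw [Finset.sum_comm]
  refine Finset.sum_congr rfl fun y _ => ?_
  rw [Finset.sum_eq_single (restr I x, restr J y)]
  · simp
  · rintro ⟨ξ, η⟩ - hne
    rw [if_neg, zero_mul]
    rintro ⟨rfl, rfl⟩
    exact hne rfl
  · simp

/-- **The fixed-marginal family is the mixture family generated by `F_{IJ}`:** the
`p`-weighted expectations of all functions depending only on `(x_I, y_J)` agree for `k`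
and `k̄` iff `k` and `k̄` have the same `p`-marginal on `(I,J)`. -/
theorem mixFam_eq_prescribedMarginals
    {N M : ℕ} {X : Fin N → Type} {Y : Fin M → Type}
    [∀ i, Fintype (X i)] [∀ i, Nonempty (X i)] [∀ i, DecidableEq (X i)]
    [∀ j, Fintype (Y j)] [∀ j, Nonempty (Y j)] [∀ j, DecidableEq (Y j)]
    (p : (∀ i, X i) → ℝ) (hp_pos : ∀ x, 0 < p x) (hp_sum : ∑ x, p x = 1)
    (k kbar : (∀ i, X i) → (∀ j, Y j) → ℝ)
    (hk_nonneg : ∀ x y, 0 ≤ k x y) (hk_sum : ∀ x, ∑ y, k x y = 1)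
    (hkbar_nonneg : ∀ x y, 0 ≤ kbar x y) (hkbar_sum : ∀ x, ∑ y, kbar x y = 1)
    (I : Finset (Fin N)) (J : Finset (Fin M)) (hJ : J.Nonempty) :
    (∀ f : (∀ i, X i) → (∀ j, Y j) → ℝ,
        (∀ x x' y y', restr I x = restr I x' → restr J y = restr J y' → f x y = f x' y') →
        ∑ x, ∑ y, p x * k x y * f x y = ∑ x, ∑ y, p x * kbar x y * f x y) ↔
      (∀ (ξ : ∀ i : I, X i.1) (η : ∀ j : J, Y j.1),
        margP p I ξ * margK p k I J ξ η = margP p I ξ * margK p kbar I J ξ η) := by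
  have hmarg (q : (∀ i, X i) → (∀ j, Y j) → ℝ) (ξ : ∀ i : I, X i.1) (η : ∀ j : J, Y j.1) :
      margP p I ξ * margK p q I J ξ η = margJoint p q I J ξ η :=
    margP_mul_margK q I J η (margP_pos hp_pos I ξ).ne'
  simp only [hmarg]
  constructor
  · intro h ξ η
    have := h (fun x y => if restr I x = ξ ∧ restr J y = η then 1 else 0)
      (fun x x' y y' hx hy => by simp only [hx, hy])
    simpa only [margJoint, mul_ite, mul_one, mul_zero] using this
  · intro h f hf
    have hfactor (x : ∀ i, X i) (y : ∀ j, Y j) :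
        f x y = f (Function.surjInv (restr_surjective I) (restr I x))
          (Function.surjInv (restr_surjective J) (restr J y)) :=
      hf _ _ _ _ (Function.surjInv_eq (restr_surjective I) _).symm
        (Function.surjInv_eq (restr_surjective J) _).symm
    let g (ξ : ∀ i : I, X i.1) (η : ∀ j : J, Y j.1) : ℝ :=
      f (Function.surjInv (restr_surjective I) ξ) (Function.surjInv (restr_surjective J) η)
    have hsum (q : (∀ i, X i) → (∀ j, Y j) → ℝ) :
        ∑ x, ∑ y, p x * q x y * f x y = ∑ ξ, ∑ η, margJoint p q I J ξ η * g ξ η := by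
      rw [← sum_mul_restr_eq_sum_margJoint]
      exact Finset.sum_congr rfl fun x _ => Finset.sum_congr rfl fun y _ => by rw [hfactor x y]
    simp only [hsum, h]
end

section
/- Let X = ∏_{i∈V} X_i and Y = ∏_{j∈W} Y_j be finite products of nonempty finite sets, p a strictly positive probability distribution on X, I ⊆ V, J ⊆ W with J nonempty, k ∈ K(X;Y) a strictly positive channel, and k̄ ∈ K(X_I;Y_J) a strictly positive prescribed marginal channel. Define σ_{IJ}^{k̄} k (x,y) := k(x;y) · k̄(x_I;y_J)/k(x_I;y_J) and the normalized IJ-scaling Nσ_{IJ}^{k̄} k (x,y) := σ_{IJ}^{k̄} k (x,y) / Z(x) with Z(x) := ∑_{y'} σ_{IJ}^{k̄} k (x,y'). Then Nσ_{IJ}^{k̄} k is a channel, and its joint with p is obtained from the joint scaling followed by input rescaling: p (Nσ_{IJ}^{k̄} k) = σ_{[N]}^{p} ( σ_{IJ}^{p k̄} (pk) ), where σ_{[N]}^{p} q (x,y) := q(x,y) · p(x)/q(x) with q(x) = ∑_y q(x,y). -/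
open scoped BigOperators ENNReal

variable {N M : ℕ} {X : Fin N → Type} {Y : Fin M → Type}

/-- The unnormalized `IJ`-scaling of a channel,
`σ_{IJ}^{k̄} k (x,y) = k(x;y) · k̄(x_I;y_J) / k(x_I;y_J)`. -/
noncomputable def chScale [∀ i, Fintype (X i)] [∀ i, DecidableEq (X i)]
    [∀ j, Fintype (Y j)] [∀ j, DecidableEq (Y j)]
    (p : (∀ i, X i) → ℝ) (k : (∀ i, X i) → (∀ j, Y j) → ℝ)
    (I : Finset (Fin N)) (J : Finset (Fin M))
    (kbar : (∀ i : I, X i.1) → (∀ j : J, Y j.1) → ℝ)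
    (x : ∀ i, X i) (y : ∀ j, Y j) : ℝ :=
  k x y * kbar (restr I x) (restr J y) / margK p k I J (restr I x) (restr J y)

/-- The normalized `IJ`-scaling `Nσ_{IJ}^{k̄} k (x,y) = σ_{IJ}^{k̄} k (x,y) / Z(x)`,
with `Z(x) = ∑_{y'} σ_{IJ}^{k̄} k (x,y')`. -/
noncomputable def chScaleN [∀ i, Fintype (X i)] [∀ i, DecidableEq (X i)]
    [∀ j, Fintype (Y j)] [∀ j, DecidableEq (Y j)]
    (p : (∀ i, X i) → ℝ) (k : (∀ i, X i) → (∀ j, Y j) → ℝ)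
    (I : Finset (Fin N)) (J : Finset (Fin M))
    (kbar : (∀ i : I, X i.1) → (∀ j : J, Y j.1) → ℝ)
    (x : ∀ i, X i) (y : ∀ j, Y j) : ℝ :=
  chScale p k I J kbar x y / ∑ y', chScale p k I J kbar x y'

/-- Marginals of a strictly positive distribution are strictly positive at restricted points. -/
theorem margP_restr_pos [∀ i, Fintype (X i)] [∀ i, DecidableEq (X i)]
    {p : (∀ i, X i) → ℝ} (hp : ∀ x, 0 < p x) (I : Finset (Fin N)) (x : ∀ i, X i) :
    0 < margP p I (restr I x) :=
  Finset.sum_pos' (fun x' _ => by split_ifs <;> simp [(hp x').le])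
    ⟨x, Finset.mem_univ x, by simpa using hp x⟩

/-- Joint marginals of a strictly positive channel are strictly positive at restricted points. -/
theorem margJoint_restr_pos [∀ i, Fintype (X i)] [∀ i, DecidableEq (X i)]
    [∀ j, Fintype (Y j)] [∀ j, DecidableEq (Y j)]
    {p : (∀ i, X i) → ℝ} {k : (∀ i, X i) → (∀ j, Y j) → ℝ}
    (hp : ∀ x, 0 < p x) (hk : ∀ x y, 0 < k x y)
    (I : Finset (Fin N)) (J : Finset (Fin M)) (x : ∀ i, X i) (y : ∀ j, Y j) :
    0 < margJoint p k I J (restr I x) (restr J y) := by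
  have h : ∀ x' y', 0 ≤ if restr I x' = restr I x ∧ restr J y' = restr J y
      then p x' * k x' y' else 0 := fun x' y' => by
    split_ifs
    exacts [(mul_pos (hp x') (hk x' y')).le, le_rfl]
  exact Finset.sum_pos' (fun x' _ => Finset.sum_nonneg fun y' _ => h x' y')
    ⟨x, Finset.mem_univ x, Finset.sum_pos' (fun y' _ => h x y')
      ⟨y, Finset.mem_univ y, by simpa using mul_pos (hp x) (hk x y)⟩⟩

/-- The channel marginal is the joint marginal divided by the input marginal. -/
theorem margK_eq_margJoint_div [∀ i, Fintype (X i)] [∀ i, DecidableEq (X i)]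
    [∀ j, Fintype (Y j)] [∀ j, DecidableEq (Y j)]
    (p : (∀ i, X i) → ℝ) (k : (∀ i, X i) → (∀ j, Y j) → ℝ)
    (I : Finset (Fin N)) (J : Finset (Fin M))
    (ξ : ∀ i : I, X i.1) (η : ∀ j : J, Y j.1) :
    margK p k I J ξ η = margJoint p k I J ξ η / margP p I ξ := by
  simp only [margK, margJoint, Finset.sum_div, ite_div, zero_div, div_mul_eq_mul_div]

/-- **Joint level of the normalized `IJ`-scaling:** `Nσ_{IJ}^{k̄} k` is a channel, and
`p (Nσ_{IJ}^{k̄} k) = σ_{[N]}^{p} (σ_{IJ}^{p k̄} (pk))`, i.e. the joint of the normalized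
scaling is the joint scaling followed by rescaling of the input marginal to `p`. -/
theorem joint_of_normalizedScaling
    {N M : ℕ} {X : Fin N → Type} {Y : Fin M → Type}
    [∀ i, Fintype (X i)] [∀ i, Nonempty (X i)] [∀ i, DecidableEq (X i)]
    [∀ j, Fintype (Y j)] [∀ j, Nonempty (Y j)] [∀ j, DecidableEq (Y j)]
    (p : (∀ i, X i) → ℝ) (hp_pos : ∀ x, 0 < p x) (hp_sum : ∑ x, p x = 1)
    (I : Finset (Fin N)) (J : Finset (Fin M)) (hJ : J.Nonempty)
    (k : (∀ i, X i) → (∀ j, Y j) → ℝ)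
    (hk_pos : ∀ x y, 0 < k x y) (hk_sum : ∀ x, ∑ y, k x y = 1)
    (kbar : (∀ i : I, X i.1) → (∀ j : J, Y j.1) → ℝ)
    (hkbar_pos : ∀ ξ η, 0 < kbar ξ η) (hkbar_sum : ∀ ξ, ∑ η, kbar ξ η = 1)
    (jq : (∀ i, X i) → (∀ j, Y j) → ℝ)
    (hjq : jq = fun x y => p x * k x y
      * (margP p I (restr I x) * kbar (restr I x) (restr J y))
      / margJoint p k I J (restr I x) (restr J y)) :
    ((∀ x y, 0 ≤ chScaleN p k I J kbar x y) ∧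
      (∀ x, ∑ y, chScaleN p k I J kbar x y = 1)) ∧
    (∀ x y, p x * chScaleN p k I J kbar x y = jq x y * p x / ∑ y', jq x y') := by
  have hscale_pos : ∀ x y, 0 < chScale p k I J kbar x y := fun x y => by
    rw [chScale, margK_eq_margJoint_div]
    exact div_pos (mul_pos (hk_pos x y) (hkbar_pos _ _))
      (div_pos (margJoint_restr_pos hp_pos hk_pos I J x y) (margP_restr_pos hp_pos I x))
  have hsum_pos : ∀ x, 0 < ∑ y, chScale p k I J kbar x y := fun x =>
    Finset.sum_pos (fun y _ => hscale_pos x y) Finset.univ_nonempty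
  have hjq_eq : ∀ x y, jq x y = p x * chScale p k I J kbar x y := fun x y => by
    have hP := (margP_restr_pos hp_pos I x).ne'
    have hQ := (margJoint_restr_pos hp_pos hk_pos I J x y).ne'
    rw [hjq, chScale, margK_eq_margJoint_div]
    field_simp
  refine ⟨⟨fun x y => (div_pos (hscale_pos x y) (hsum_pos x)).le, fun x => ?_⟩, fun x y => ?_⟩
  · simp only [chScaleN, ← Finset.sum_div]
    exact div_self (hsum_pos x).ne'
  · have hp := (hp_pos x).ne'
    have hs := (hsum_pos x).ne'
    simp only [hjq_eq, ← Finset.mul_sum, chScaleN]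
    field_simp
end
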